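/- Let Δ > 0 and ε' > 0, and let μ = Lap(2Δ/ε') ⊗ Lap(4Δ/ε') be the product of the two Laplace measures on ℝ². For all reals T, t, α, v with α ≥ t ≥ 0 and v ≤ T − α, μ({(x,y) : v + y ≥ T − t + x}) ≤ exp(−ε'(α−t)/(6Δ)) − (1/4)·exp(−ε'(α−t)/(3Δ)). (The bound on the probability that the sieve step fails to filter out a query whose value is at most T − α, used in the paper's Type II error bound.) -/

import Mathlib

open MeasureTheory

/-- The Laplace measure `Lap(b)` on ℝ: the measure with density
`x ↦ (1/(2b)) · exp(−|x|/b)` with respect to Lebesgue measure. -/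
noncomputable def laplaceMeasure (b : ℝ) : Measure ℝ :=
  volume.withDensity (fun x => ENNReal.ofReal ((1 / (2 * b)) * Real.exp (-|x| / b)))

lemma lap_Iic (b a : ℝ) (hb : 0 < b) (ha : 0 ≤ a) :
    laplaceMeasure b (Set.Iic (-a)) = ENNReal.ofReal (Real.exp (-a / b) / 2) := by
  have hb' : 0 < b⁻¹ := inv_pos.2 hb
  rw [laplaceMeasure, withDensity_apply _ measurableSet_Iic]
  have h1 : ∫⁻ x in Set.Iic (-a), ENNReal.ofReal ((1 / (2 * b)) * Real.exp (-|x| / b))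
      = ∫⁻ x in Set.Iic (-a), ENNReal.ofReal ((1 / (2 * b)) * Real.exp (b⁻¹ * x)) := by
    refine setLIntegral_congr_fun measurableSet_Iic fun x hx => ?_
    have hx' : x ≤ 0 := le_trans hx (by linarith)
    simp only [abs_of_nonpos hx', neg_neg, div_eq_inv_mul x b]
  rw [h1, ← ofReal_integral_eq_lintegral_ofReal
    ((integrableOn_exp_mul_Iic hb' _).const_mul _)
    (Filter.Eventually.of_forall fun x => by positivity),
    integral_const_mul, integral_exp_mul_Iic hb']
  congr 1
  rw [show b⁻¹ * -a = -a / b by ring]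
  field_simp

lemma lap_Ioi (b a : ℝ) (hb : 0 < b) (ha : 0 ≤ a) :
    laplaceMeasure b (Set.Ioi a) = ENNReal.ofReal (Real.exp (-a / b) / 2) := by
  have hb' : -b⁻¹ < 0 := neg_lt_zero.2 (inv_pos.2 hb)
  rw [laplaceMeasure, withDensity_apply _ measurableSet_Ioi]
  have h1 : ∫⁻ x in Set.Ioi a, ENNReal.ofReal ((1 / (2 * b)) * Real.exp (-|x| / b))
      = ∫⁻ x in Set.Ioi a, ENNReal.ofReal ((1 / (2 * b)) * Real.exp (-b⁻¹ * x)) := by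
    refine setLIntegral_congr_fun measurableSet_Ioi fun x hx => ?_
    have hx' : 0 ≤ x := le_trans ha (le_of_lt hx)
    have : -x / b = -b⁻¹ * x := by ring
    simp only [abs_of_nonneg hx', this]
  rw [h1, ← ofReal_integral_eq_lintegral_ofReal
    ((integrableOn_exp_mul_Ioi hb' _).const_mul _)
    (Filter.Eventually.of_forall fun x => by positivity),
    integral_const_mul, integral_exp_mul_Ioi hb']
  congr 1
  rw [show -b⁻¹ * a = -a / b by ring]
  field_simp

lemma lap_prob (b : ℝ) (hb : 0 < b) : IsProbabilityMeasure (laplaceMeasure b) := by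
  constructor
  have h1 := lap_Iic b 0 hb le_rfl
  have h2 := lap_Ioi b 0 hb le_rfl
  rw [← Set.Iic_union_Ioi (a := (0:ℝ)),
    measure_union (Set.Iic_disjoint_Ioi le_rfl) measurableSet_Ioi, h2]
  rw [neg_zero] at h1
  rw [h1, ← ENNReal.ofReal_add (by positivity) (by positivity)]
  norm_num

theorem stmt_17 (Δ ε' : ℝ) (hΔ : 0 < Δ) (hε' : 0 < ε')
    (T t α v : ℝ) (ht : 0 ≤ t) (hαt : t ≤ α) (hv : v ≤ T - α) :
    (laplaceMeasure (2 * Δ / ε')).prod (laplaceMeasure (4 * Δ / ε'))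
        {p : ℝ × ℝ | T - t + p.1 ≤ v + p.2} ≤
      ENNReal.ofReal (Real.exp (-(ε' * (α - t)) / (6 * Δ)) -
        (1 / 4) * Real.exp (-(ε' * (α - t)) / (3 * Δ))) := by
  have hb1 : 0 < 2 * Δ / ε' := by positivity
  have hb2 : 0 < 4 * Δ / ε' := by positivity
  have := lap_prob _ hb1
  have := lap_prob _ hb2
  have hs : 0 ≤ α - t := by linarith
  have hA := lap_Iic _ ((α - t) / 3) hb1 (by linarith)
  have hB := lap_Ioi _ (2 * (α - t) / 3) hb2 (by linarith)
  set q := Real.exp (-(ε' * (α - t)) / (6 * Δ)) with hq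
  have e1 : -((α - t) / 3) / (2 * Δ / ε') = -(ε' * (α - t)) / (6 * Δ) := by
    field_simp; ring
  have e2 : -(2 * (α - t) / 3) / (4 * Δ / ε') = -(ε' * (α - t)) / (6 * Δ) := by
    field_simp; ring
  have e3 : Real.exp (-(ε' * (α - t)) / (3 * Δ)) = q * q := by
    rw [hq, ← Real.exp_add]; congr 1; field_simp; ring
  rw [e1, ← hq] at hA
  rw [e2, ← hq] at hB
  have hq0 : 0 < q := Real.exp_pos _
  have hq1 : q ≤ 1 := by
    rw [hq, Real.exp_le_one_iff, neg_div]
    exact neg_nonpos.2 (by positivity)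
  have hC : laplaceMeasure (2 * Δ / ε') (Set.Ioi (-((α - t) / 3)))
      = ENNReal.ofReal (1 - q / 2) := by
    rw [← Set.compl_Iic, prob_compl_eq_one_sub measurableSet_Iic, hA,
      ENNReal.ofReal_sub _ (by positivity), ENNReal.ofReal_one]
  have hsub : {p : ℝ × ℝ | T - t + p.1 ≤ v + p.2} ⊆
      (Set.Iic (-((α - t) / 3)) ×ˢ Set.univ) ∪
      (Set.Ioi (-((α - t) / 3)) ×ˢ Set.Ioi (2 * (α - t) / 3)) := by
    rintro ⟨x, y⟩ h
    simp only [Set.mem_ofPred_eq] at h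
    by_cases hx : x ≤ -((α - t) / 3)
    · left; exact ⟨hx, trivial⟩
    · right
      rw [not_le] at hx
      refine ⟨hx, ?_⟩
      simp only [Set.mem_Ioi]
      linarith
  refine (measure_mono hsub).trans ((measure_union_le _ _).trans ?_)
  rw [Measure.prod_prod, Measure.prod_prod, hA, hB, hC, measure_univ, mul_one,
    ← ENNReal.ofReal_mul (by linarith), ← ENNReal.ofReal_add (by positivity)
      (mul_nonneg (by linarith) (by positivity)), e3]
  apply ENNReal.ofReal_le_ofReal
  apply le_of_eq
  ring
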